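/- Let 𝒯 be a regular T-mesh and g ∈ S̄(1,1,0,0,𝒯). Then I(g) ∈ S̄(2,2,1,1,𝒯) if and only if: (1) for every horizontal l-edge of 𝒯 with endpoints (x₁,y) and (x₂,y), ∫_{x₁}^{x₂} ∂g/∂y(s,y−) ds = ∫_{x₁}^{x₂} ∂g/∂y(s,y+) ds; and (2) for every vertical l-edge of 𝒯 with endpoints (x,y₁) and (x,y₂), ∫_{y₁}^{y₂} ∂g/∂x(x−,t) dt = ∫_{y₁}^{y₂} ∂g/∂x(x+,t) dt. Here the partial derivatives of g are taken cell-wise and ∂g/∂y(s,y±), ∂g/∂x(x±,t) denote one-sided limits. -/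

import Mathlib

open Filter Set MeasureTheory
open scoped Topology

noncomputable section

/-- A closed axis-aligned rectangle with positive side lengths. -/
structure Rect where
  xmin : ℝ
  xmax : ℝ
  ymin : ℝ
  ymax : ℝ
  hx : xmin < xmax
  hy : ymin < ymax

/-- The set of points of a rectangle. -/
def Rect.toSet (c : Rect) : Set (ℝ × ℝ) :=
  Set.Icc c.xmin c.xmax ×ˢ Set.Icc c.ymin c.ymax

/-- A regular T-mesh: finitely many cells (closed axis-aligned rectangles) with pairwise
disjoint interiors whose union is a closed axis-aligned rectangle. -/
structure TMesh where
  cells : Set Rect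
  outer : Rect
  finite_cells : cells.Finite
  pairwise_disjoint : cells.Pairwise fun c d => Disjoint (interior c.toSet) (interior d.toSet)
  union_eq : (⋃ c ∈ cells, c.toSet) = outer.toSet

/-- The region occupied by a T-mesh. -/
def TMesh.Omega (T : TMesh) : Set (ℝ × ℝ) := T.outer.toSet

/-- The edge skeleton of a T-mesh: the union of the boundaries of all cells. -/
def TMesh.skeleton (T : TMesh) : Set (ℝ × ℝ) := ⋃ c ∈ T.cells, frontier c.toSet

/-- A vertex of the mesh: a corner of some cell. -/
def IsVertexOf (T : TMesh) (p : ℝ × ℝ) : Prop :=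
  ∃ c ∈ T.cells, (p.1 = c.xmin ∨ p.1 = c.xmax) ∧ (p.2 = c.ymin ∨ p.2 = c.ymax)

/-- A crossing vertex: an interior vertex from which four small axis-parallel segments
stay inside the edge skeleton. -/
def IsCrossingVertex (T : TMesh) (p : ℝ × ℝ) : Prop :=
  IsVertexOf T p ∧ p ∈ interior T.Omega ∧
    ∃ ε > (0 : ℝ), segment ℝ p (p + (ε, 0)) ⊆ T.skeleton ∧
      segment ℝ p (p - (ε, 0)) ⊆ T.skeleton ∧
      segment ℝ p (p + (0, ε)) ⊆ T.skeleton ∧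
      segment ℝ p (p - (0, ε)) ⊆ T.skeleton

/-- A horizontal closed segment of positive length. -/
def IsHorizSeg (s : Set (ℝ × ℝ)) : Prop :=
  ∃ a b y : ℝ, a < b ∧ s = Set.Icc a b ×ˢ ({y} : Set ℝ)

/-- A vertical closed segment of positive length. -/
def IsVertSeg (s : Set (ℝ × ℝ)) : Prop :=
  ∃ x a b : ℝ, a < b ∧ s = ({x} : Set ℝ) ×ˢ Set.Icc a b

/-- An l-edge: a maximal axis-parallel closed segment of positive length contained in the
edge skeleton. -/
def IsLEdge (T : TMesh) (s : Set (ℝ × ℝ)) : Prop :=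
  (IsHorizSeg s ∨ IsVertSeg s) ∧ s ⊆ T.skeleton ∧
    ∀ s', (IsHorizSeg s' ∨ IsVertSeg s') → s' ⊆ T.skeleton → s ⊆ s' → s' = s

def IsBoundaryLEdge (T : TMesh) (s : Set (ℝ × ℝ)) : Prop :=
  IsLEdge T s ∧ s ⊆ frontier T.Omega

def IsInteriorLEdge (T : TMesh) (s : Set (ℝ × ℝ)) : Prop :=
  IsLEdge T s ∧ ¬ s ⊆ frontier T.Omega

/-- There is a horizontal l-edge with endpoints `(a,y)`, `(b,y)`. -/
def HorizLEdgeAt (T : TMesh) (a b y : ℝ) : Prop :=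
  a < b ∧ IsLEdge T (Set.Icc a b ×ˢ ({y} : Set ℝ))

/-- The number `V⁺` of crossing vertices. -/
def crossingCount (T : TMesh) : ℕ := {p | IsCrossingVertex T p}.ncard

/-- The number `E` of interior l-edges. -/
def interiorLEdgeCount (T : TMesh) : ℕ := {s | IsInteriorLEdge T s}.ncard

/-- The number `F` of cells. -/
def cellCount (T : TMesh) : ℕ := T.cells.ncard

/-! Partial derivatives (within a set) and smoothness. -/

def pdXW (S : Set (ℝ × ℝ)) (f : ℝ × ℝ → ℝ) : ℝ × ℝ → ℝ :=
  fun p => derivWithin (fun x => f (x, p.2)) {x | (x, p.2) ∈ S} p.1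

def pdYW (S : Set (ℝ × ℝ)) (f : ℝ × ℝ → ℝ) : ℝ × ℝ → ℝ :=
  fun p => derivWithin (fun y => f (p.1, y)) {y | (p.1, y) ∈ S} p.2

/-- The mixed partial derivative `∂^{i+j} f/∂x^i∂y^j`, taken within the set `S`. -/
def mpW (S : Set (ℝ × ℝ)) (i j : ℕ) (f : ℝ × ℝ → ℝ) : ℝ × ℝ → ℝ :=
  (pdYW S)^[j] ((pdXW S)^[i] f)

/-- `f` has continuous mixed partials `∂^{i+j}f/∂x^i∂y^j` on `S` for all `0 ≤ i ≤ α`,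
`0 ≤ j ≤ β` (smoothness indices `α, β ∈ ℤ` may be `-1`, in which case nothing is required
in that variable). -/
def SmoothWithin (S : Set (ℝ × ℝ)) (α β : ℤ) (f : ℝ × ℝ → ℝ) : Prop :=
  (∀ i j : ℕ, (i : ℤ) ≤ α → (j : ℤ) ≤ β → ContinuousOn (mpW S i j f) S) ∧
  (∀ i : ℕ, (i : ℤ) < α → ∀ p ∈ S,
    HasDerivWithinAt (fun x => (pdXW S)^[i] f (x, p.2)) ((pdXW S)^[i+1] f p)
      {x | (x, p.2) ∈ S} p.1) ∧
  (∀ i j : ℕ, (i : ℤ) ≤ α → (j : ℤ) < β → ∀ p ∈ S,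
    HasDerivWithinAt (fun y => mpW S i j f (p.1, y)) (mpW S i (j+1) f p)
      {y | (p.1, y) ∈ S} p.2)

/-- `f` agrees on each cell of `T` with a polynomial of bidegree at most `(m,n)`. -/
def PiecewisePoly (m n : ℕ) (T : TMesh) (f : ℝ × ℝ → ℝ) : Prop :=
  ∀ c ∈ T.cells, ∃ p : MvPolynomial (Fin 2) ℝ,
    p.degreeOf 0 ≤ m ∧ p.degreeOf 1 ≤ n ∧
    ∀ q ∈ c.toSet, f q = MvPolynomial.eval ![q.1, q.2] p

/-- The spline space with homogeneous boundary conditions `S̄(m,n,α,β,T)`. -/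
def SBar (m n : ℕ) (α β : ℤ) (T : TMesh) : Set (ℝ × ℝ → ℝ) :=
  {f | (∀ p, p ∉ T.Omega → f p = 0) ∧ PiecewisePoly m n T f ∧ SmoothWithin Set.univ α β f}

/-- The spline space `S(m,n,α,β,T)` over the T-mesh: membership only constrains the values
on the occupied region `Ω` (smoothness is required within `Ω`). -/
def SOn (m n : ℕ) (α β : ℤ) (T : TMesh) : Set (ℝ × ℝ → ℝ) :=
  {f | PiecewisePoly m n T f ∧ SmoothWithin T.Omega α β f}

/-- The set of functions `S` is a linear space of dimension `d`. -/
def HasDim (S : Set (ℝ × ℝ → ℝ)) (d : ℕ) : Prop :=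
  ∃ b : Fin d → (ℝ × ℝ → ℝ), (∀ i, b i ∈ S) ∧ LinearIndependent ℝ b ∧
    ∀ f ∈ S, ∃ c : Fin d → ℝ, f = ∑ i, c i • b i

/-- The linear space `S` has dimension at least `d`. -/
def DimGE (S : Set (ℝ × ℝ → ℝ)) (d : ℕ) : Prop :=
  ∃ b : Fin d → (ℝ × ℝ → ℝ), (∀ i, b i ∈ S) ∧ LinearIndependent ℝ b

/-- The set of functions `S`, regarded as a space of functions on `Ω` (i.e. modulo the
values outside `Ω`), has dimension `d`. -/
def HasDimOn (Ω : Set (ℝ × ℝ)) (S : Set (ℝ × ℝ → ℝ)) (d : ℕ) : Prop :=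
  ∃ b : Fin d → (ℝ × ℝ → ℝ), (∀ i, b i ∈ S) ∧
    LinearIndependent ℝ (fun i => Ω.restrict (b i)) ∧
    ∀ f ∈ S, ∃ c : Fin d → ℝ, Set.EqOn f (∑ i, c i • b i) Ω

/-! The integration operator `I` and one-sided limits. -/

/-- `I(g)(x,y) = ∫_{-∞}^x ∫_{-∞}^y g(s,t) dt ds`. -/
def Ig (g : ℝ × ℝ → ℝ) : ℝ × ℝ → ℝ :=
  fun p => ∫ s in Set.Iic p.1, (∫ t in Set.Iic p.2, g (s, t))

/-- `g(s, y−)`, the one-sided limit from below in the second variable. -/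
def limBelowY (g : ℝ × ℝ → ℝ) (y s : ℝ) : ℝ := limUnder (𝓝[<] y) fun t => g (s, t)
/-- `g(s, y+)`. -/
def limAboveY (g : ℝ × ℝ → ℝ) (y s : ℝ) : ℝ := limUnder (𝓝[>] y) fun t => g (s, t)
/-- `g(x−, t)`. -/
def limLeftX (g : ℝ × ℝ → ℝ) (x t : ℝ) : ℝ := limUnder (𝓝[<] x) fun s => g (s, t)
/-- `g(x+, t)`. -/
def limRightX (g : ℝ × ℝ → ℝ) (x t : ℝ) : ℝ := limUnder (𝓝[>] x) fun s => g (s, t)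

/-- The (cell-wise) partial derivative in `x`. -/
def pdX (f : ℝ × ℝ → ℝ) : ℝ × ℝ → ℝ := fun p => deriv (fun x => f (x, p.2)) p.1
/-- The (cell-wise) partial derivative in `y`. -/
def pdY (f : ℝ × ℝ → ℝ) : ℝ × ℝ → ℝ := fun p => deriv (fun y => f (p.1, y)) p.2

/-- The union of the open interiors of the cells. -/
def cellInteriors (T : TMesh) : Set (ℝ × ℝ) := ⋃ c ∈ T.cells, interior c.toSet

open Classical in
/-- The cell-wise mixed partial derivative `∂²f/∂x∂y`, set to `0` off the cell interiors. -/
def Dmix (T : TMesh) (f : ℝ × ℝ → ℝ) : ℝ × ℝ → ℝ :=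
  fun p => if p ∈ cellInteriors T then pdX (pdY f) p else 0

/-! Extended T-meshes. -/

/-- The skeleton of a tensor-product mesh with grid lines `X 0 < ⋯ < X (2m+1)` and
`Y 0 < ⋯ < Y (2n+1)`. -/
def gridSkeleton (m n : ℕ) (X Y : ℕ → ℝ) : Set (ℝ × ℝ) :=
  {p : ℝ × ℝ | (∃ i ≤ 2 * m + 1, p.1 = X i) ∧ Y 0 ≤ p.2 ∧ p.2 ≤ Y (2 * n + 1)} ∪
  {p : ℝ × ℝ | (∃ j ≤ 2 * n + 1, p.2 = Y j) ∧ X 0 ≤ p.1 ∧ p.1 ≤ X (2 * m + 1)}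

/-- The straight extensions, up to the rectangle `[x0,x1] × [y0,y1]`, of every l-edge of `T`
having an endpoint on the boundary of the region of `T`. -/
def extSegs (T : TMesh) (x0 x1 y0 y1 : ℝ) : Set (ℝ × ℝ) :=
  {p : ℝ × ℝ | ∃ a b y, HorizLEdgeAt T a b y ∧ a = T.outer.xmin ∧
      p.2 = y ∧ x0 ≤ p.1 ∧ p.1 ≤ a} ∪
  {p : ℝ × ℝ | ∃ a b y, HorizLEdgeAt T a b y ∧ b = T.outer.xmax ∧
      p.2 = y ∧ b ≤ p.1 ∧ p.1 ≤ x1} ∪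
  {p : ℝ × ℝ | ∃ x a b, a < b ∧ IsLEdge T (({x} : Set ℝ) ×ˢ Set.Icc a b) ∧ a = T.outer.ymin ∧
      p.1 = x ∧ y0 ≤ p.2 ∧ p.2 ≤ a} ∪
  {p : ℝ × ℝ | ∃ x a b, a < b ∧ IsLEdge T (({x} : Set ℝ) ×ˢ Set.Icc a b) ∧ b = T.outer.ymax ∧
      p.1 = x ∧ b ≤ p.2 ∧ p.2 ≤ y1}

/-- `Te` is an extension of `T` associated with `S(m,n,m-1,n-1,T)`: a tensor-product mesh with
`2(m+1)` vertical and `2(n+1)` horizontal grid lines whose central rectangle is the region of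
`T`, together with `T` and the straight extensions of all boundary-reaching edges of `T`. -/
def IsExtensionOf (m n : ℕ) (T Te : TMesh) : Prop :=
  ∃ X Y : ℕ → ℝ,
    (∀ i < 2 * m + 1, X i < X (i + 1)) ∧ (∀ j < 2 * n + 1, Y j < Y (j + 1)) ∧
    X m = T.outer.xmin ∧ X (m + 1) = T.outer.xmax ∧
    Y n = T.outer.ymin ∧ Y (n + 1) = T.outer.ymax ∧
    Te.outer.xmin = X 0 ∧ Te.outer.xmax = X (2 * m + 1) ∧
    Te.outer.ymin = Y 0 ∧ Te.outer.ymax = Y (2 * n + 1) ∧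
    Te.skeleton = T.skeleton ∪ gridSkeleton m n X Y ∪
      extSegs T (X 0) (X (2 * m + 1)) (Y 0) (Y (2 * n + 1))

/-! Hierarchical T-meshes. -/

/-- `T` is a tensor-product mesh. -/
def IsTensorMesh (T : TMesh) : Prop :=
  ∃ (p q : ℕ) (x y : ℕ → ℝ), 0 < p ∧ 0 < q ∧
    (∀ i < p, x i < x (i + 1)) ∧ (∀ j < q, y j < y (j + 1)) ∧
    T.cells = {c : Rect | ∃ i < p, ∃ j < q,
      c.xmin = x i ∧ c.xmax = x (i + 1) ∧ c.ymin = y j ∧ c.ymax = y (j + 1)}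

/-- The four equal subcells obtained by subdividing a cell by the two segments joining the
midpoints of opposite edges. -/
def Rect.quads (c : Rect) : Set Rect :=
  { ⟨c.xmin, (c.xmin + c.xmax) / 2, c.ymin, (c.ymin + c.ymax) / 2,
      by linarith [c.hx], by linarith [c.hy]⟩,
    ⟨(c.xmin + c.xmax) / 2, c.xmax, c.ymin, (c.ymin + c.ymax) / 2,
      by linarith [c.hx], by linarith [c.hy]⟩,
    ⟨c.xmin, (c.xmin + c.xmax) / 2, (c.ymin + c.ymax) / 2, c.ymax,
      by linarith [c.hx], by linarith [c.hy]⟩,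
    ⟨(c.xmin + c.xmax) / 2, c.xmax, (c.ymin + c.ymax) / 2, c.ymax,
      by linarith [c.hx], by linarith [c.hy]⟩ }

/-- `T'` is obtained from `T` by subdividing exactly the cells in `S` into four quadrants. -/
def StepSubdiv (T T' : TMesh) (S : Set Rect) : Prop :=
  S ⊆ T.cells ∧ T'.outer = T.outer ∧
    T'.cells = (T.cells \ S) ∪ ⋃ c ∈ S, Rect.quads c

/-- A hierarchical T-mesh: the recursive construction `𝒯⁰, 𝒯¹, …, 𝒯^M`. -/
structure HierMesh where
  M : ℕ
  level : ℕ → TMesh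
  subdivided : ℕ → Set Rect
  tensor0 : IsTensorMesh (level 0)
  step : ∀ k < M, StepSubdiv (level k) (level (k + 1)) (subdivided k)

/-- The final mesh `𝒯 = 𝒯^M`. -/
def HierMesh.final (H : HierMesh) : TMesh := H.level H.M

/-- Two cells share a (horizontal or vertical) edge segment of positive length. -/
def EdgeAdjacent (c d : Rect) : Prop :=
  c ≠ d ∧ ∃ s : Set (ℝ × ℝ), (IsHorizSeg s ∨ IsVertSeg s) ∧ s ⊆ c.toSet ∩ d.toSet

/-- `c` is an isolated subdivided cell at step `k`: it is subdivided at step `k`, but no cell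
of the level-`k` mesh sharing a horizontal or vertical edge with it is subdivided then. -/
def IsIsolatedAt (H : HierMesh) (k : ℕ) (c : Rect) : Prop :=
  k < H.M ∧ c ∈ H.subdivided k ∧
    ∀ d ∈ (H.level k).cells, EdgeAdjacent c d → d ∉ H.subdivided k

/-- The isolated subdivided cells occurring in the construction of `H`. -/
def isoCells (H : HierMesh) : Set Rect := {c | ∃ k, IsIsolatedAt H k c}

/-- A regular T-mesh is crossing-vertex connected: any two distinct crossing vertices are
joined by a poly-line of axis-parallel mesh edges all of whose (corner) joints are crossing
vertices. -/
def IsCVConnected (T : TMesh) : Prop :=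
  ∀ u v : ℝ × ℝ, IsCrossingVertex T u → IsCrossingVertex T v → u ≠ v →
    ∃ (N : ℕ) (p : ℕ → ℝ × ℝ), p 0 = u ∧ p N = v ∧
      (∀ i < N, p i ≠ p (i + 1) ∧ segment ℝ (p i) (p (i + 1)) ⊆ T.skeleton ∧
        ((p i).1 = (p (i + 1)).1 ∨ (p i).2 = (p (i + 1)).2)) ∧
      (∀ i, 0 < i → i < N →
        (((p (i - 1)).2 = (p i).2 ∧ (p i).1 = (p (i + 1)).1) ∨
         ((p (i - 1)).1 = (p i).1 ∧ (p i).2 = (p (i + 1)).2)) →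
        IsCrossingVertex T (p i))

/-- The level of an l-edge `s`: the first level of the hierarchy whose skeleton contains it. -/
def LEdgeLevel (H : HierMesh) (s : Set (ℝ × ℝ)) (k : ℕ) : Prop :=
  s ⊆ (H.level k).skeleton ∧ ∀ j < k, ¬ s ⊆ (H.level j).skeleton

/-- `yb < yi < yt` are the heights of the two support l-edges of the horizontal l-edge
`[a,b] × {yi}` of the hierarchical mesh `H`: for a level-0 l-edge, the nearest level-0
horizontal l-edges below and above; for a level-`(k+1)` l-edge, the heights of the bottom
and top edges of a cell subdivided at step `k` whose inserted cross has its horizontal arm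
on the l-edge. -/
def SupportHeights (H : HierMesh) (a b yi yb yt : ℝ) : Prop :=
  yb < yi ∧ yi < yt ∧
  ((LEdgeLevel H (Set.Icc a b ×ˢ ({yi} : Set ℝ)) 0 ∧
     (∃ a' b', HorizLEdgeAt (H.level 0) a' b' yb) ∧
     (∃ a' b', HorizLEdgeAt (H.level 0) a' b' yt) ∧
     (∀ y a' b', HorizLEdgeAt (H.level 0) a' b' y → ¬(yb < y ∧ y < yt ∧ y ≠ yi))) ∨
   (∃ k, LEdgeLevel H (Set.Icc a b ×ˢ ({yi} : Set ℝ)) (k + 1) ∧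
     ∃ c ∈ H.subdivided k, c.ymin = yb ∧ c.ymax = yt ∧ (c.ymin + c.ymax) / 2 = yi ∧
       a ≤ c.xmin ∧ c.xmax ≤ b))

/-- `U j` is a proper submesh of `U i` (its region is strictly contained in that of `U i`). -/
def ProperSubmesh {ι : Type*} (U : ι → TMesh) (j i : ι) : Prop :=
  j ≠ i ∧ (U j).Omega ⊆ (U i).Omega ∧ (U j).Omega ≠ (U i).Omega

/-! The CVR graph. -/

/-- An edge of the CVR graph: a segment joining two consecutive crossing vertices along an
l-edge. -/
def IsCVREdge (T : TMesh) (s : Set (ℝ × ℝ)) : Prop :=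
  ∃ u v : ℝ × ℝ, u ≠ v ∧ s = segment ℝ u v ∧ IsCrossingVertex T u ∧ IsCrossingVertex T v ∧
    (∃ l, IsLEdge T l ∧ segment ℝ u v ⊆ l) ∧
    ∀ w ∈ segment ℝ u v, IsCrossingVertex T w → w = u ∨ w = v

/-- The union of the edges of the CVR graph, as a plane set. -/
def cvrGraphSet (T : TMesh) : Set (ℝ × ℝ) := ⋃₀ {s | IsCVREdge T s}

/-- The number of edges of the CVR graph. -/
def cvrEdgeCount (T : TMesh) : ℕ := {s | IsCVREdge T s}.ncard

/-- The number of bounded faces of the CVR graph: bounded connected components of the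
complement of the union of its edges. -/
def cvrFaceCount (T : TMesh) : ℕ :=
  {U : Set (ℝ × ℝ) | (∃ p ∈ (cvrGraphSet T)ᶜ, U = connectedComponentIn (cvrGraphSet T)ᶜ p) ∧
     Bornology.IsBounded U}.ncard

/-! ### Rectangles, the mirrored mesh and the skeleton -/

theorem Rect.mem_toSet {c : Rect} {x y : ℝ} :
    (x, y) ∈ c.toSet ↔ (c.xmin ≤ x ∧ x ≤ c.xmax) ∧ c.ymin ≤ y ∧ y ≤ c.ymax := Iff.rfl

theorem Rect.mem_interior {c : Rect} {x y : ℝ} :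
    (x, y) ∈ interior c.toSet ↔ (c.xmin < x ∧ x < c.xmax) ∧ c.ymin < y ∧ y < c.ymax := by
  rw [Rect.toSet, interior_prod_eq, interior_Icc, interior_Icc]
  exact Iff.rfl

theorem Rect.isClosed_toSet (c : Rect) : IsClosed c.toSet := isClosed_Icc.prod isClosed_Icc

theorem Rect.closure_interior (c : Rect) : closure (interior c.toSet) = c.toSet := by
  rw [Rect.toSet, interior_prod_eq, interior_Icc, interior_Icc, closure_prod_eq,
    closure_Ioo c.hx.ne, closure_Ioo c.hy.ne]

theorem Rect.frontier_eq (c : Rect) : frontier c.toSet = c.toSet \ interior c.toSet :=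
  c.isClosed_toSet.frontier_eq

theorem TMesh.mem_skeleton {T : TMesh} {p : ℝ × ℝ} :
    p ∈ T.skeleton ↔ ∃ c ∈ T.cells, p ∈ c.toSet ∧ p ∉ interior c.toSet := by
  simp only [TMesh.skeleton, Rect.frontier_eq, Set.mem_iUnion, Set.mem_sdiff, exists_prop]

theorem TMesh.mem_Omega {T : TMesh} {p : ℝ × ℝ} : p ∈ T.Omega ↔ ∃ c ∈ T.cells, p ∈ c.toSet := by
  rw [TMesh.Omega, ← T.union_eq]; simp

theorem TMesh.isClosed_skeleton (T : TMesh) : IsClosed T.skeleton :=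
  T.finite_cells.isClosed_biUnion fun _ _ => isClosed_frontier

theorem TMesh.skeleton_subset (T : TMesh) : T.skeleton ⊆ T.Omega := fun p hp => by
  obtain ⟨c, hc, h, -⟩ := TMesh.mem_skeleton.1 hp
  exact TMesh.mem_Omega.2 ⟨c, hc, h⟩

theorem TMesh.notMem_skeleton_of_mem_interior {T : TMesh} {c : Rect} (hc : c ∈ T.cells)
    {p : ℝ × ℝ} (hp : p ∈ interior c.toSet) : p ∉ T.skeleton := by
  intro h
  obtain ⟨d, hd, h1, h2⟩ := TMesh.mem_skeleton.1 h
  have hne : c ≠ d := by rintro rfl; exact h2 hp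
  rw [← d.closure_interior] at h1
  obtain ⟨q, hq1, hq2⟩ := mem_closure_iff.1 h1 _ isOpen_interior hp
  exact Set.disjoint_left.1 (T.pairwise_disjoint hc hd hne) hq1 hq2

theorem TMesh.exists_mem_interior {T : TMesh} {p : ℝ × ℝ} (hp : p ∈ T.Omega)
    (hs : p ∉ T.skeleton) : ∃ c ∈ T.cells, p ∈ interior c.toSet := by
  obtain ⟨c, hc, h⟩ := TMesh.mem_Omega.1 hp
  by_contra! h'
  exact hs (TMesh.mem_skeleton.2 ⟨c, hc, h, h' c hc⟩)

/-- The mirror image of a rectangle in the diagonal. -/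
def Rect.swap (c : Rect) : Rect := ⟨c.ymin, c.ymax, c.xmin, c.xmax, c.hy, c.hx⟩

theorem Rect.swap_swap (c : Rect) : c.swap.swap = c := rfl

theorem Rect.toSet_swap (c : Rect) : c.swap.toSet = Prod.swap ⁻¹' c.toSet := by
  ext ⟨x, y⟩
  simp only [Rect.toSet, Rect.swap, Set.mem_prod, Set.mem_preimage, Prod.fst_swap, Prod.snd_swap]
  exact and_comm

theorem Rect.interior_swap (c : Rect) :
    interior c.swap.toSet = Prod.swap ⁻¹' interior c.toSet := by
  rw [Rect.toSet_swap]
  exact ((Homeomorph.prodComm ℝ ℝ).preimage_interior c.toSet).symm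

/-- The mirror image of a T-mesh in the diagonal. -/
def TMesh.swap (T : TMesh) : TMesh where
  cells := Rect.swap ⁻¹' T.cells
  outer := T.outer.swap
  finite_cells := T.finite_cells.preimage
    ((Function.LeftInverse.injective Rect.swap_swap).injOn)
  pairwise_disjoint := fun c hc d hd hcd => by
    have h := T.pairwise_disjoint hc hd
      ((Function.LeftInverse.injective Rect.swap_swap).ne hcd)
    simp only [Rect.interior_swap] at h
    exact Disjoint.of_preimage Prod.swap_surjective h
  union_eq := by
    rw [Rect.toSet_swap, ← T.union_eq]
    ext p
    simp only [Set.mem_iUnion, Set.mem_preimage, exists_prop]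
    constructor
    · rintro ⟨c, hc, hp⟩
      exact ⟨c.swap, hc, by rw [Rect.toSet_swap]; simpa using hp⟩
    · rintro ⟨c, hc, hp⟩
      exact ⟨c.swap, hc, by rw [Rect.toSet_swap]; exact hp⟩

theorem TMesh.Omega_swap (T : TMesh) : T.swap.Omega = Prod.swap ⁻¹' T.Omega :=
  T.outer.toSet_swap

theorem TMesh.skeleton_swap (T : TMesh) : T.swap.skeleton = Prod.swap ⁻¹' T.skeleton := by
  ext p
  simp only [TMesh.mem_skeleton, Set.mem_preimage]
  constructor
  · rintro ⟨c, hc, h1, h2⟩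
    refine ⟨c.swap, hc, ?_, ?_⟩
    · rw [Rect.toSet_swap]; simpa using h1
    · rw [Rect.interior_swap]; simpa using h2
  · rintro ⟨c, hc, h1, h2⟩
    refine ⟨c.swap, hc, ?_, ?_⟩
    · rw [Rect.toSet_swap]; simpa using h1
    · rw [Rect.interior_swap]; simpa using h2

theorem mem_skeleton_swap {T : TMesh} {x y : ℝ} :
    (x, y) ∈ T.swap.skeleton ↔ (y, x) ∈ T.skeleton := by
  rw [TMesh.skeleton_swap]; rfl

theorem isLEdge_horiz_iff (T : TMesh) {a b y : ℝ} (hab : a < b) :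
    IsLEdge T (Set.Icc a b ×ˢ ({y} : Set ℝ)) ↔
      Set.Icc a b ⊆ {s | (s, y) ∈ T.skeleton} ∧
        ∀ a' b', Set.Icc a' b' ⊆ {s | (s, y) ∈ T.skeleton} → a' ≤ a → b ≤ b' →
          a' = a ∧ b' = b := by
  have key : ∀ u v : ℝ, Set.Icc u v ×ˢ ({y} : Set ℝ) ⊆ T.skeleton ↔
      Set.Icc u v ⊆ {s | (s, y) ∈ T.skeleton} := by
    intro u v
    constructor
    · intro h s hs
      exact h ⟨hs, rfl⟩
    · rintro h ⟨s, t⟩ ⟨hs, rfl⟩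
      exact h hs
  constructor
  · rintro ⟨-, h1, h2⟩
    refine ⟨(key a b).1 h1, fun a' b' h ha hb => ?_⟩
    have := h2 (Set.Icc a' b' ×ˢ ({y} : Set ℝ)) (Or.inl ⟨a', b', y, by linarith, rfl⟩)
      ((key a' b').2 h) (Set.prod_mono (Set.Icc_subset_Icc ha hb) subset_rfl)
    have h3 : (a', y) ∈ Set.Icc a b ×ˢ ({y} : Set ℝ) := by
      rw [← this]; exact ⟨⟨le_rfl, by linarith⟩, rfl⟩
    have h4 : (b', y) ∈ Set.Icc a b ×ˢ ({y} : Set ℝ) := by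
      rw [← this]; exact ⟨⟨by linarith, le_rfl⟩, rfl⟩
    exact ⟨le_antisymm ha h3.1.1, le_antisymm h4.1.2 hb⟩
  · rintro ⟨h1, h2⟩
    refine ⟨Or.inl ⟨a, b, y, hab, rfl⟩, (key a b).2 h1, ?_⟩
    rintro s' (⟨a', b', y', -, rfl⟩ | ⟨x', a', b', -, rfl⟩) hs' hsub
    · have ha := hsub (show (a, y) ∈ _ from ⟨⟨le_rfl, hab.le⟩, rfl⟩)
      have hb := hsub (show (b, y) ∈ _ from ⟨⟨hab.le, le_rfl⟩, rfl⟩)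
      obtain rfl : y = y' := ha.2
      obtain ⟨rfl, rfl⟩ := h2 a' b' ((key a' b').1 hs') ha.1.1 hb.1.2
      rfl
    · have ha := hsub (show (a, y) ∈ _ from ⟨⟨le_rfl, hab.le⟩, rfl⟩)
      have hb := hsub (show (b, y) ∈ _ from ⟨⟨hab.le, le_rfl⟩, rfl⟩)
      have : a = b := (show a = x' from ha.1).trans (show b = x' from hb.1).symm
      exact absurd this hab.ne

theorem isSeg_preimage_swap {s : Set (ℝ × ℝ)} (h : IsHorizSeg s ∨ IsVertSeg s) :
    IsHorizSeg (Prod.swap ⁻¹' s) ∨ IsVertSeg (Prod.swap ⁻¹' s) := by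
  rcases h with ⟨a, b, y, hab, rfl⟩ | ⟨x, a, b, hab, rfl⟩
  · exact Or.inr ⟨y, a, b, hab, Set.preimage_swap_prod _ _⟩
  · exact Or.inl ⟨a, b, x, hab, Set.preimage_swap_prod _ _⟩

theorem preimage_swap_preimage_swap (s : Set (ℝ × ℝ)) :
    Prod.swap ⁻¹' (Prod.swap ⁻¹' s) = s := by
  ext p; simp

theorem IsLEdge.preimage_swap {T : TMesh} {s : Set (ℝ × ℝ)} (h : IsLEdge T s) :
    IsLEdge T.swap (Prod.swap ⁻¹' s) := by
  refine ⟨isSeg_preimage_swap h.1, ?_, fun s' hs' hsk hsub => ?_⟩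
  · rw [TMesh.skeleton_swap]
    exact Set.preimage_mono h.2.1
  · have h1 := h.2.2 (Prod.swap ⁻¹' s') (isSeg_preimage_swap hs')
      (by
        have := Set.preimage_mono (f := Prod.swap) hsk
        rwa [TMesh.skeleton_swap, preimage_swap_preimage_swap] at this)
      (by
        have := Set.preimage_mono (f := Prod.swap) hsub
        rwa [preimage_swap_preimage_swap] at this)
    rw [← h1, preimage_swap_preimage_swap]

theorem isLEdge_vert_iff (T : TMesh) {x a b : ℝ} :
    IsLEdge T (({x} : Set ℝ) ×ˢ Set.Icc a b) ↔
      IsLEdge T.swap (Set.Icc a b ×ˢ ({x} : Set ℝ)) := by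
  constructor
  · intro h
    have := h.preimage_swap
    rwa [Set.preimage_swap_prod] at this
  · intro h
    have := h.preimage_swap
    rwa [Set.preimage_swap_prod] at this

/-! ### Integrals over the maximal intervals of a closed set -/

theorem forall_maximal_integral_eq_zero_iff {S : Set ℝ} (hS : IsClosed S) {P : Set ℝ}
    (hPfin : P.Finite) {m : ℝ} (hm : ∀ s ∈ S, m < s)
    (hP : ∀ p x, p < x → (∀ q ∈ P, q ≤ p ∨ x ≤ q) → x ∉ S → ∀ s, p < s → s < x → s ∉ S)
    {J : ℝ → ℝ} (hJc : Continuous J) (hJ : ∀ s, s ∉ S → J s = 0) :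
    (∀ a b, a < b → Set.Icc a b ⊆ S →
        (∀ a' b', Set.Icc a' b' ⊆ S → a' ≤ a → b ≤ b' → a' = a ∧ b' = b) →
        ∫ s in a..b, J s = 0) ↔
      ∀ x, x ∉ S → ∫ s in m..x, J s = 0 := by
  have hint : ∀ u v, IntervalIntegrable J volume u v := fun u v => hJc.intervalIntegrable u v
  have hHc : Continuous fun x => ∫ s in m..x, J s :=
    intervalIntegral.continuous_primitive hint m
  have hHcl : IsClosed {x | ∫ s in m..x, J s = 0} := isClosed_eq hHc continuous_const
  have hsub : ∀ u v, (∫ s in u..v, J s) = (∫ s in m..v, J s) - ∫ s in m..u, J s := fun u v =>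
    (intervalIntegral.integral_interval_sub_left (hint _ _) (hint _ _)).symm
  constructor
  · intro h
    suffices H : ∀ n : ℕ, ∀ x, x ∉ S → {q ∈ P | q < x}.ncard = n → ∫ s in m..x, J s = 0 from
      fun x hx => H _ x hx rfl
    intro n
    induction n using Nat.strong_induction_on with
    | _ n ih =>
    intro x hx hn
    have hfin : {q ∈ P | q < x}.Finite := hPfin.subset fun q hq => hq.1
    rcases Set.eq_empty_or_nonempty {q ∈ P | q < x} with he | hne
    · have hno : ∀ q ∈ P, x ≤ q := fun q hq => by
        by_contra! hlt
        exact (he ▸ (⟨hq, hlt⟩ : q ∈ {q ∈ P | q < x}) : q ∈ (∅ : Set ℝ))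
      have hz : ∀ s ≤ x, J s = 0 := by
        intro s hs
        rcases hs.eq_or_lt with rfl | hs
        · exact hJ _ hx
        · exact hJ _ (hP (s - 1) x (by linarith) (fun q hq => Or.inr (hno q hq)) hx s
            (by linarith) hs)
      rw [intervalIntegral.integral_congr (g := fun _ => (0 : ℝ)), intervalIntegral.integral_zero]
      intro s hs
      rcases le_total m x with hmx | hmx
      · rw [Set.uIcc_of_le hmx] at hs
        exact hz s hs.2
      · rw [Set.uIcc_of_ge hmx] at hs
        exact hJ s fun hsS => absurd (hm s hsS) (not_lt.2 hs.2)
    · obtain ⟨p, ⟨hpP, hpx⟩, hmax⟩ := Set.exists_max_image _ (fun q => q) hfin hne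
      have hgap : ∀ s, p < s → s < x → s ∉ S := hP p x hpx (fun q hq => by
        by_contra! hlt
        exact absurd (hmax q ⟨hq, hlt.2⟩) (not_le.2 hlt.1)) hx
      have hpx0 : ∫ s in p..x, J s = 0 := by
        rw [intervalIntegral.integral_congr_Ioo_of_le (g := fun _ => (0 : ℝ)) hpx.le
          (fun s hs => hJ s (hgap s hs.1 hs.2)), intervalIntegral.integral_zero]
      have IH : ∀ z, z ∉ S → z ≤ p → ∫ s in m..z, J s = 0 := fun z hz hzp =>
        ih _ (hn ▸ Set.ncard_lt_ncard ⟨fun q hq => ⟨hq.1, hq.2.trans_le (hzp.trans hpx.le)⟩,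
          fun hh => absurd (hh ⟨hpP, hpx⟩).2 (not_lt.2 hzp)⟩ hfin) z hz rfl
      rw [hsub] at hpx0
      suffices hp0 : ∫ s in m..p, J s = 0 by linarith
      by_cases hpS : p ∈ S
      · set A : Set ℝ := {a | a ≤ p ∧ Set.Icc a p ⊆ S} with hA
        have hpA : p ∈ A := ⟨le_rfl, by simpa using hpS⟩
        have hAb : BddBelow A := ⟨m, fun a ha => (hm a (ha.2 ⟨le_rfl, ha.1⟩)).le⟩
        have hap : sInf A ≤ p := csInf_le hAb hpA
        have hIoc : Set.Ioc (sInf A) p ⊆ S := fun s hs => by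
          obtain ⟨a', ha', hlt⟩ := exists_lt_of_csInf_lt ⟨p, hpA⟩ hs.1
          exact ha'.2 ⟨hlt.le, hs.2⟩
        have hIcc : Set.Icc (sInf A) p ⊆ S := by
          rcases hap.eq_or_lt with he | hlt
          · rw [he]; simpa using hpS
          · rw [← closure_Ioc hlt.ne]
            exact closure_minimal hIoc hS
        have hcl : sInf A ∈ closure {z | z ∉ S ∧ z < sInf A} := by
          rw [Metric.mem_closure_iff]
          intro ε hε
          by_contra! hcon
          have : sInf A - ε / 2 ∈ A := by
            refine ⟨by linarith, fun s hs => ?_⟩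
            rcases le_or_gt (sInf A) s with h1 | h1
            · exact hIcc ⟨h1, hs.2⟩
            · by_contra hsS
              have := hcon s ⟨hsS, h1⟩
              rw [Real.dist_eq, abs_of_pos (by linarith)] at this
              linarith [hs.1]
          linarith [csInf_le hAb this]
        have ha0 : ∫ s in m..sInf A, J s = 0 :=
          closure_minimal (fun z hz => IH z hz.1 (hz.2.le.trans hap)) hHcl hcl
        rcases hap.eq_or_lt with he | hlt
        · rwa [he] at ha0
        · have := h (sInf A) p hlt hIcc (fun a' b' hsS ha' hb' => by
            have ha'A : a' ∈ A := ⟨ha'.trans hap, fun s hs => hsS ⟨hs.1, hs.2.trans hb'⟩⟩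
            refine ⟨le_antisymm ha' (csInf_le hAb ha'A), ?_⟩
            by_contra hne'
            have hpb : p < b' := lt_of_le_of_ne hb' (Ne.symm hne')
            have h1 : p < min b' x := lt_min hpb hpx
            have h2 := min_le_left b' x
            have h3 := min_le_right b' x
            exact hgap ((p + min b' x) / 2) (by linarith) (by linarith)
              (hsS ⟨by linarith, by linarith⟩))
          rw [hsub, ha0, sub_zero] at this
          exact this
      · exact IH p hpS le_rfl
  · intro h a b hab hsubS hmaxl
    have ha : a ∈ closure Sᶜ := by
      rw [closure_compl]
      intro hint'
      obtain ⟨ε, hε, hb⟩ := Metric.mem_nhds_iff.1 (mem_interior_iff_mem_nhds.1 hint')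
      have := hmaxl (a - ε / 2) b (fun s hs => by
        rcases le_total a s with h1 | h1
        · exact hsubS ⟨h1, hs.2⟩
        · exact hb (by rw [Real.ball_eq_Ioo]; constructor <;> linarith [hs.1])) (by linarith) le_rfl
      linarith [this.1]
    have hb : b ∈ closure Sᶜ := by
      rw [closure_compl]
      intro hint'
      obtain ⟨ε, hε, hb⟩ := Metric.mem_nhds_iff.1 (mem_interior_iff_mem_nhds.1 hint')
      have := hmaxl a (b + ε / 2) (fun s hs => by
        rcases le_total s b with h1 | h1
        · exact hsubS ⟨hs.1, h1⟩
        · exact hb (by rw [Real.ball_eq_Ioo]; constructor <;> linarith [hs.2])) le_rfl (by linarith)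
      linarith [this.2]
    have h0 : closure Sᶜ ⊆ {x | ∫ s in m..x, J s = 0} := closure_minimal h hHcl
    rw [hsub, h0 ha, h0 hb, sub_zero]

/-! ### Piecewise bilinear functions -/

/-- A continuous function, zero off the mesh, which is bilinear on each cell. -/
structure IsBilinearSpline (T : TMesh) (g : ℝ × ℝ → ℝ) : Prop where
  continuous : Continuous g
  zero : ∀ p, p ∉ T.Omega → g p = 0
  bilin : ∀ c ∈ T.cells, ∃ a b k d : ℝ, ∀ x y, (x, y) ∈ c.toSet →
    g (x, y) = a + b * x + k * y + d * (x * y)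

namespace IsBilinearSpline

variable {T : TMesh} {g : ℝ × ℝ → ℝ}

theorem swap (hg : IsBilinearSpline T g) : IsBilinearSpline T.swap (g ∘ Prod.swap) where
  continuous := hg.continuous.comp continuous_swap
  zero := fun p hp => hg.zero _ (by rwa [TMesh.Omega_swap] at hp)
  bilin := fun c hc => by
    obtain ⟨a, b, k, d, h⟩ := hg.bilin c.swap hc
    refine ⟨a, k, b, d, fun x y hxy => ?_⟩
    have := h y x (by rw [Rect.toSet_swap]; exact hxy)
    simp only [Function.comp_apply, Prod.swap_prod_mk, this]
    ring

theorem zero_of_notMem_interior (hg : IsBilinearSpline T g) {p : ℝ × ℝ}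
    (hp : p ∉ interior T.Omega) : g p = 0 := by
  have h : p ∈ closure T.Omegaᶜ := by rwa [closure_compl]
  exact closure_minimal (t := {p | g p = 0}) hg.zero
    (isClosed_eq hg.continuous continuous_const) h

theorem zero_of_le (hg : IsBilinearSpline T g) {s t : ℝ}
    (h : s ≤ T.outer.xmin ∨ T.outer.xmax ≤ s ∨ t ≤ T.outer.ymin ∨ T.outer.ymax ≤ t) :
    g (s, t) = 0 := by
  refine hg.zero_of_notMem_interior fun hmem => ?_
  have := Rect.mem_interior.1 hmem
  rcases h with h | h | h | h <;> linarith [this.1.1, this.1.2, this.2.1, this.2.2]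

theorem continuous_row (hg : IsBilinearSpline T g) (t : ℝ) : Continuous fun s => g (s, t) :=
  hg.continuous.comp (Continuous.prodMk_left t)

end IsBilinearSpline

/-- The ordinates of the horizontal sides of the cells and of the outer rectangle. -/
def TMesh.ordinates (T : TMesh) : Set ℝ :=
  Rect.ymin '' T.cells ∪ Rect.ymax '' T.cells ∪ {T.outer.ymin, T.outer.ymax}

theorem TMesh.finite_ordinates (T : TMesh) : T.ordinates.Finite :=
  ((T.finite_cells.image _).union (T.finite_cells.image _)).union (Set.toFinite _)

theorem TMesh.ymin_mem_ordinates {T : TMesh} {c : Rect} (hc : c ∈ T.cells) :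
    c.ymin ∈ T.ordinates := Or.inl (Or.inl ⟨c, hc, rfl⟩)

theorem TMesh.ymax_mem_ordinates {T : TMesh} {c : Rect} (hc : c ∈ T.cells) :
    c.ymax ∈ T.ordinates := Or.inl (Or.inr ⟨c, hc, rfl⟩)

namespace IsBilinearSpline

variable {T : TMesh} {g : ℝ × ℝ → ℝ}

theorem affine_between_ordinates (hg : IsBilinearSpline T g) {u v : ℝ} (huv : u < v)
    (hQ : ∀ q ∈ T.ordinates, q ≤ u ∨ v ≤ q) (s : ℝ) :
    ∃ α β : ℝ, ∀ t ∈ Set.Icc u v, g (s, t) = α + β * t := by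
  by_cases hmem : (s, (u + v) / 2) ∈ T.Omega
  · obtain ⟨c, hc, h⟩ := TMesh.mem_Omega.1 hmem
    have h := Rect.mem_toSet.1 h
    obtain ⟨a, b, k, d, hb⟩ := hg.bilin c hc
    refine ⟨a + b * s, k + d * s, fun t ht => ?_⟩
    rw [hb s t (Rect.mem_toSet.2 ⟨h.1, ?_, ?_⟩)]
    · ring
    · rcases hQ _ (TMesh.ymin_mem_ordinates hc) with h1 | h1 <;> linarith [ht.1, h.2.1]
    · rcases hQ _ (TMesh.ymax_mem_ordinates hc) with h1 | h1 <;> linarith [ht.2, h.2.2]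
  · refine ⟨0, 0, fun t ht => ?_⟩
    rw [zero_mul, add_zero]
    apply hg.zero_of_le
    have h1 := hQ T.outer.ymin (Or.inr (Or.inl rfl))
    have h2 := hQ T.outer.ymax (Or.inr (Or.inr rfl))
    by_contra! hcon
    refine hmem (Rect.mem_toSet.2 ⟨⟨hcon.1.le, hcon.2.1.le⟩, ?_, ?_⟩)
    · rcases h1 with h1 | h1 <;> linarith [ht.1, ht.2]
    · rcases h2 with h2 | h2 <;> linarith [ht.1, ht.2]

/-- Around each ordinate there is a strip, thin enough that `g` is affine in `y` on both of its
halves, and on all of it above points off the skeleton. -/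
theorem exists_strip (hg : IsBilinearSpline T g) (y : ℝ) : ∃ h > 0,
    (∀ s, ∀ t ∈ Set.Icc (y - h) y, g (s, t) = g (s, y) + (t - y) * ((g (s, y) - g (s, y - h)) / h)) ∧
    (∀ s, ∀ t ∈ Set.Icc y (y + h), g (s, t) = g (s, y) + (t - y) * ((g (s, y + h) - g (s, y)) / h)) ∧
    ∀ s, (s, y) ∉ T.skeleton → (g (s, y + h) - g (s, y)) / h = (g (s, y) - g (s, y - h)) / h := by
  have hnhds : (T.ordinates \ {y})ᶜ ∈ 𝓝 y :=
    (T.finite_ordinates.subset Set.sdiff_subset).isClosed.isOpen_compl.mem_nhds (by simp)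
  obtain ⟨ε, hε, hball⟩ := Metric.mem_nhds_iff.1 hnhds
  rw [Real.ball_eq_Ioo] at hball
  have hQ : ∀ q ∈ T.ordinates, q = y ∨ q ≤ y - ε ∨ y + ε ≤ q := by
    intro q hq
    by_contra! hcon
    exact hball ⟨hcon.2.1, hcon.2.2⟩ ⟨hq, hcon.1⟩
  refine ⟨ε / 2, by positivity, fun s t ht => ?_, fun s t ht => ?_, fun s hs => ?_⟩
  · obtain ⟨α, β, h⟩ := hg.affine_between_ordinates (u := y - ε / 2) (v := y) (by linarith)
      (fun q hq => by rcases hQ q hq with h | h | h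
                      · right; linarith
                      · left; linarith
                      · right; linarith) s
    rw [h t ht, h y ⟨by linarith, le_rfl⟩, h (y - ε / 2) ⟨le_rfl, by linarith⟩]
    field_simp
    ring
  · obtain ⟨α, β, h⟩ := hg.affine_between_ordinates (u := y) (v := y + ε / 2) (by linarith)
      (fun q hq => by rcases hQ q hq with h | h | h
                      · left; linarith
                      · left; linarith
                      · right; linarith) s
    rw [h t ht, h y ⟨le_rfl, by linarith⟩, h (y + ε / 2) ⟨by linarith, le_rfl⟩]
    field_simp
    ring
  · by_cases hΩ : (s, y) ∈ T.Omega
    · obtain ⟨c, hc, hmem⟩ := TMesh.exists_mem_interior hΩ hs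
      have hmem := Rect.mem_interior.1 hmem
      obtain ⟨a, b, k, d, hb⟩ := hg.bilin c hc
      have h1 : c.ymin ≤ y - ε := by
        rcases hQ _ (TMesh.ymin_mem_ordinates hc) with h | h | h <;> linarith [hmem.2.1]
      have h2 : y + ε ≤ c.ymax := by
        rcases hQ _ (TMesh.ymax_mem_ordinates hc) with h | h | h <;> linarith [hmem.2.2]
      have hx : c.xmin ≤ s ∧ s ≤ c.xmax := ⟨hmem.1.1.le, hmem.1.2.le⟩
      rw [hb s y ⟨hx, by constructor <;> dsimp only <;> linarith⟩,
        hb s (y + ε / 2) ⟨hx, by constructor <;> dsimp only <;> linarith⟩,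
        hb s (y - ε / 2) ⟨hx, by constructor <;> dsimp only <;> linarith⟩]
      ring
    · have hQ1 := hQ T.outer.ymin (Or.inr (Or.inl rfl))
      have hQ2 := hQ T.outer.ymax (Or.inr (Or.inr rfl))
      have hz : ∀ t ∈ Set.Icc (y - ε / 2) (y + ε / 2), g (s, t) = 0 := by
        intro t ht
        refine hg.zero_of_le ?_
        by_contra! hcon
        apply hΩ
        refine Rect.mem_toSet.2 ⟨⟨hcon.1.le, hcon.2.1.le⟩, ?_, ?_⟩
        · rcases hQ1 with h | h | h <;> linarith [ht.1, ht.2]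
        · rcases hQ2 with h | h | h <;> linarith [ht.1, ht.2]
      rw [hz y ⟨by linarith, by linarith⟩, hz (y + ε / 2) ⟨by linarith, le_rfl⟩,
        hz (y - ε / 2) ⟨le_rfl, by linarith⟩]

end IsBilinearSpline

theorem tendsto_deriv_of_eqOn_Ioo {φ : ℝ → ℝ} {u v k d : ℝ} (l : Filter ℝ)
    (hl : Set.Ioo u v ∈ l) (hφ : ∀ t ∈ Set.Ioo u v, φ t = k + t * d) :
    Tendsto (deriv φ) l (𝓝 d) := by
  refine tendsto_const_nhds.congr' ?_
  filter_upwards [hl] with t ht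
  have h1 : φ =ᶠ[𝓝 t] fun t => k + t * d := by
    filter_upwards [Ioo_mem_nhds ht.1 ht.2] with r hr using hφ r hr
  rw [h1.deriv_eq]
  simp

/-- The integral `∫ g(s,y) ds` over all `s ≤ x`, for functions vanishing off the mesh. -/
def rowInt (T : TMesh) (g : ℝ × ℝ → ℝ) (x y : ℝ) : ℝ :=
  ∫ s in (T.outer.xmin - 1)..x, g (s, y)

namespace IsBilinearSpline

variable {T : TMesh} {g : ℝ × ℝ → ℝ}

/-- The jumps of `∂g/∂y` integrate to zero over every horizontal l-edge iff all the row integrals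
that end off the skeleton are locally affine. -/
theorem horiz_condition_iff (hg : IsBilinearSpline T g) :
    (∀ a b y : ℝ, HorizLEdgeAt T a b y →
        (∫ s in a..b, limBelowY (pdY g) y s) = ∫ s in a..b, limAboveY (pdY g) y s) ↔
      ∀ x y, (x, y) ∉ T.skeleton → ∃ α β : ℝ, ∀ᶠ t in 𝓝 y, rowInt T g x t = α + β * t := by
  suffices H : ∀ y : ℝ, (∀ a b : ℝ, HorizLEdgeAt T a b y →
        (∫ s in a..b, limBelowY (pdY g) y s) = ∫ s in a..b, limAboveY (pdY g) y s) ↔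
      ∀ x, (x, y) ∉ T.skeleton → ∃ α β : ℝ, ∀ᶠ t in 𝓝 y, rowInt T g x t = α + β * t from
    ⟨fun h x y => (H y).1 (fun a b => h a b y) x, fun h a b y => (H y).2 (fun x => h x y) a b⟩
  intro y
  obtain ⟨h, hh, hl, hr, hs⟩ := hg.exists_strip y
  set L : ℝ → ℝ := fun s => (g (s, y) - g (s, y - h)) / h with hL
  set R : ℝ → ℝ := fun s => (g (s, y + h) - g (s, y)) / h with hR
  have hLc : Continuous L := ((hg.continuous_row _).sub (hg.continuous_row _)).div_const h
  have hRc : Continuous R := ((hg.continuous_row _).sub (hg.continuous_row _)).div_const h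
  have hlim1 : ∀ s, limBelowY (pdY g) y s = L s := fun s =>
    Tendsto.limUnder_eq (tendsto_deriv_of_eqOn_Ioo (φ := fun t => g (s, t)) _
      (Ioo_mem_nhdsLT (show y - h < y by linarith)) (k := g (s, y) - y * L s)
      (fun t ht => by rw [hl s t ⟨ht.1.le, ht.2.le⟩]; ring))
  have hlim2 : ∀ s, limAboveY (pdY g) y s = R s := fun s =>
    Tendsto.limUnder_eq (tendsto_deriv_of_eqOn_Ioo (φ := fun t => g (s, t)) _
      (Ioo_mem_nhdsGT (show y < y + h by linarith)) (k := g (s, y) - y * R s)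
      (fun t ht => by rw [hr s t ⟨ht.1.le, ht.2.le⟩]; ring))
  have hJ : ∀ u v : ℝ, ∫ s in u..v, (R s - L s) = (∫ s in u..v, R s) - ∫ s in u..v, L s :=
    fun u v => intervalIntegral.integral_sub (hRc.intervalIntegrable _ _)
      (hLc.intervalIntegrable _ _)
  have hcont : Continuous fun s : ℝ => (s, y) := Continuous.prodMk_left y
  have key := forall_maximal_integral_eq_zero_iff (S := {s | (s, y) ∈ T.skeleton})
    (T.isClosed_skeleton.preimage hcont)
    (P := Rect.xmin '' T.cells ∪ Rect.xmax '' T.cells)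
    ((T.finite_cells.image _).union (T.finite_cells.image _))
    (m := T.outer.xmin - 1)
    (fun s hsS => by
      have := (Rect.mem_toSet.1 (T.skeleton_subset hsS)).1.1
      linarith)
    (fun p x hpx hP hx s hps hsx hsS => by
      obtain ⟨c, hc, h1, h2⟩ := TMesh.mem_skeleton.1 hsS
      refine hx (TMesh.mem_skeleton.2 ⟨c, hc, ?_⟩)
      rw [Rect.mem_toSet] at h1 ⊢
      rw [Rect.mem_interior] at h2 ⊢
      have e1 : c.xmin ≤ p := by
        rcases hP c.xmin (Or.inl ⟨c, hc, rfl⟩) with h | h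
        · exact h
        · linarith [h1.1.1]
      have e2 : x ≤ c.xmax := by
        rcases hP c.xmax (Or.inr ⟨c, hc, rfl⟩) with h | h
        · linarith [h1.1.2]
        · exact h
      exact ⟨⟨⟨by linarith, e2⟩, h1.2⟩,
        fun h3 => h2 ⟨⟨by linarith, by linarith⟩, h3.2⟩⟩)
    (J := fun s => R s - L s) (hRc.sub hLc) (fun s hsS => sub_eq_zero.2 (hs s hsS))
  have hleft : (∀ a b : ℝ, HorizLEdgeAt T a b y →
        (∫ s in a..b, limBelowY (pdY g) y s) = ∫ s in a..b, limAboveY (pdY g) y s) ↔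
      ∀ a b, a < b → Set.Icc a b ⊆ {s | (s, y) ∈ T.skeleton} →
        (∀ a' b', Set.Icc a' b' ⊆ {s | (s, y) ∈ T.skeleton} → a' ≤ a → b ≤ b' →
          a' = a ∧ b' = b) →
        ∫ s in a..b, (R s - L s) = 0 := by
    simp only [hlim1, hlim2]
    refine forall₂_congr fun a b => ?_
    rw [hJ, sub_eq_zero, HorizLEdgeAt]
    constructor
    · intro H hab h1 h2
      exact (H ⟨hab, (isLEdge_horiz_iff T hab).2 ⟨h1, h2⟩⟩).symm
    · rintro H ⟨hab, h1⟩
      rw [isLEdge_horiz_iff T hab] at h1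
      exact (H hab h1.1 h1.2).symm
  rw [hleft, key]
  refine forall₂_congr fun x hx => ?_
  rw [hJ]
  set m := T.outer.xmin - 1 with hm
  have hGl : ∀ t ∈ Set.Icc (y - h) y,
      rowInt T g x t = rowInt T g x y + (t - y) * ∫ s in m..x, L s := by
    intro t ht
    rw [rowInt, rowInt, ← intervalIntegral.integral_const_mul, ← intervalIntegral.integral_add
      ((hg.continuous_row y).intervalIntegrable _ _)
      ((hLc.const_mul _).intervalIntegrable _ _)]
    exact intervalIntegral.integral_congr fun s _ => hl s t ht
  have hGr : ∀ t ∈ Set.Icc y (y + h),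
      rowInt T g x t = rowInt T g x y + (t - y) * ∫ s in m..x, R s := by
    intro t ht
    rw [rowInt, rowInt, ← intervalIntegral.integral_const_mul, ← intervalIntegral.integral_add
      ((hg.continuous_row y).intervalIntegrable _ _)
      ((hRc.const_mul _).intervalIntegrable _ _)]
    exact intervalIntegral.integral_congr fun s _ => hr s t ht
  constructor
  · intro H
    refine ⟨rowInt T g x y - y * ∫ s in m..x, L s, ∫ s in m..x, L s, ?_⟩
    filter_upwards [Ioo_mem_nhds (show y - h < y by linarith) (show y < y + h by linarith)]
      with t ht
    rcases le_total t y with hty | hty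
    · rw [hGl t ⟨ht.1.le, hty⟩]; ring
    · rw [hGr t ⟨hty, ht.2.le⟩, sub_eq_zero.1 H]; ring
  · rintro ⟨α, β, H⟩
    obtain ⟨ε, hε, hball⟩ := Metric.eventually_nhds_iff_ball.1 H
    rw [Real.ball_eq_Ioo] at hball
    have hδ : 0 < min h ε / 2 := by positivity
    have h1 := min_le_left h ε
    have h2 := min_le_right h ε
    set δ := min h ε / 2 with hδdef
    have e0 := hball y ⟨by linarith, by linarith⟩
    have e1 := hball (y + δ) ⟨by linarith, by linarith⟩
    have e2 := hball (y - δ) ⟨by linarith, by linarith⟩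
    rw [hGr _ ⟨by linarith, by linarith⟩] at e1
    rw [hGl _ ⟨by linarith, by linarith⟩] at e2
    have : δ * ((∫ s in m..x, R s) - ∫ s in m..x, L s) = 0 := by linear_combination e1 + e2 - 2 * e0
    exact (mul_eq_zero.1 this).resolve_left hδ.ne'

end IsBilinearSpline

/-! ### Polynomial expansions and locally affine functions -/

theorem exists_eval_eq_sum {m n : ℕ} {p : MvPolynomial (Fin 2) ℝ} (h0 : p.degreeOf 0 ≤ m)
    (h1 : p.degreeOf 1 ≤ n) : ∃ A : ℕ → ℕ → ℝ, ∀ x y : ℝ, MvPolynomial.eval ![x, y] p =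
      ∑ i ∈ Finset.range (m + 1), ∑ j ∈ Finset.range (n + 1), A i j * (x ^ i * y ^ j) := by
  rw [MvPolynomial.degreeOf_le_iff] at h0 h1
  refine ⟨fun i j => ∑ d ∈ p.support, if d 0 = i ∧ d 1 = j then p.coeff d else 0, fun x y => ?_⟩
  rw [MvPolynomial.eval_eq']
  simp only [Finset.sum_mul]
  rw [Finset.sum_congr rfl fun i _ => Finset.sum_comm, Finset.sum_comm]
  refine Finset.sum_congr rfl fun d hd => ?_
  rw [Finset.sum_eq_single (d 0), Finset.sum_eq_single (d 1)]
  · simp [Fin.prod_univ_two]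
  · intro j _ hj
    simp [hj.symm]
  · intro h
    exact absurd (Finset.mem_range.2 (Nat.lt_succ_of_le (h1 d hd))) h
  · intro i _ hi
    simp [hi.symm]
  · intro h
    exact absurd (Finset.mem_range.2 (Nat.lt_succ_of_le (h0 d hd))) h

theorem exists_mvPolynomial_eval_eq_sum (m n : ℕ) (A : ℕ → ℕ → ℝ) :
    ∃ p : MvPolynomial (Fin 2) ℝ, p.degreeOf 0 ≤ m ∧ p.degreeOf 1 ≤ n ∧
      ∀ x y : ℝ, MvPolynomial.eval ![x, y] p =
        ∑ i ∈ Finset.range (m + 1), ∑ j ∈ Finset.range (n + 1), A i j * (x ^ i * y ^ j) := by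
  have key : ∀ (k : Fin 2) (i j : ℕ), MvPolynomial.degreeOf k
      (MvPolynomial.C (A i j) * (MvPolynomial.X 0 ^ i * MvPolynomial.X 1 ^ j) :
        MvPolynomial (Fin 2) ℝ) ≤ i * (if k = 0 then 1 else 0) + j * (if k = 1 then 1 else 0) := by
    intro k i j
    refine (MvPolynomial.degreeOf_C_mul_le _ _ _).trans ((MvPolynomial.degreeOf_mul_le _ _ _).trans
      (add_le_add ?_ ?_))
    · exact (MvPolynomial.degreeOf_pow_le _ _ _).trans (by rw [MvPolynomial.degreeOf_X])
    · exact (MvPolynomial.degreeOf_pow_le _ _ _).trans (by rw [MvPolynomial.degreeOf_X])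
  refine ⟨∑ i ∈ Finset.range (m + 1), ∑ j ∈ Finset.range (n + 1),
    MvPolynomial.C (A i j) * (MvPolynomial.X 0 ^ i * MvPolynomial.X 1 ^ j), ?_, ?_, ?_⟩
  · refine (MvPolynomial.degreeOf_sum_le _ _ _).trans (Finset.sup_le fun i hi =>
      (MvPolynomial.degreeOf_sum_le _ _ _).trans (Finset.sup_le fun j hj => ?_))
    refine (key 0 i j).trans ?_
    have := Finset.mem_range.1 hi
    simp
    omega
  · refine (MvPolynomial.degreeOf_sum_le _ _ _).trans (Finset.sup_le fun i hi =>
      (MvPolynomial.degreeOf_sum_le _ _ _).trans (Finset.sup_le fun j hj => ?_))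
    refine (key 1 i j).trans ?_
    have := Finset.mem_range.1 hj
    simp
    omega
  · intro x y
    simp

theorem exists_affine_of_locally_affine {φ : ℝ → ℝ} {u v : ℝ} (huv : u < v) (hφ : Continuous φ)
    (h : ∀ y ∈ Set.Ioo u v, ∃ α β : ℝ, ∀ᶠ t in 𝓝 y, φ t = α + β * t) :
    ∃ α β : ℝ, ∀ t ∈ Set.Icc u v, φ t = α + β * t := by
  have hd : ∀ α β t : ℝ, HasDerivAt (fun t => α + β * t) β t := fun α β t => by
    simpa using ((hasDerivAt_id t).const_mul β).const_add α
  have hdiff : ∀ y ∈ Set.Ioo u v, DifferentiableAt ℝ φ y := fun y hy => by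
    obtain ⟨α, β, he⟩ := h y hy
    exact ((hd α β y).congr_of_eventuallyEq he).differentiableAt
  have hdd : ∀ y ∈ Set.Ioo u v, HasDerivAt (deriv φ) 0 y := fun y hy => by
    obtain ⟨α, β, he⟩ := h y hy
    refine (hasDerivAt_const y β).congr_of_eventuallyEq ?_
    filter_upwards [eventually_eventually_nhds.2 he] with t ht
    exact ((hd α β t).congr_of_eventuallyEq ht).deriv
  obtain ⟨w, hw⟩ : (Set.Ioo u v).Nonempty := Set.nonempty_Ioo.2 huv
  have hconst : ∀ y ∈ Set.Ioo u v, deriv φ y = deriv φ w := fun y hy =>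
    isOpen_Ioo.is_const_of_deriv_eq_zero isPreconnected_Ioo
      (fun z hz => (hdd z hz).differentiableAt.differentiableWithinAt)
      (fun z hz => (hdd z hz).deriv) hy hw
  have hsub : ∀ z ∈ Set.Ioo u v, HasDerivAt (fun t => φ t - (0 + deriv φ w * t)) 0 z :=
    fun z hz => by
      have := (hdiff z hz).hasDerivAt.fun_sub (hd 0 (deriv φ w) z)
      rwa [hconst z hz, sub_self] at this
  have hIoo : ∀ t ∈ Set.Ioo u v, φ t = (φ w - deriv φ w * w) + deriv φ w * t := fun t ht => by
    have := isOpen_Ioo.is_const_of_deriv_eq_zero isPreconnected_Ioo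
      (fun z hz => (hsub z hz).differentiableAt.differentiableWithinAt)
      (fun z hz => (hsub z hz).deriv) ht hw
    linarith
  refine ⟨φ w - deriv φ w * w, deriv φ w, fun t ht => ?_⟩
  rw [← closure_Ioo huv.ne] at ht
  exact closure_minimal (t := {t | φ t = (φ w - deriv φ w * w) + deriv φ w * t}) hIoo
    (isClosed_eq hφ (by fun_prop)) ht

theorem integral_affine (α β u v : ℝ) :
    ∫ t in u..v, (α + β * t) = α * (v - u) + β * ((v ^ 2 - u ^ 2) / 2) := by
  rw [intervalIntegral.integral_add (by simp)
    ((by fun_prop : Continuous fun t : ℝ => β * t).intervalIntegrable _ _),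
    intervalIntegral.integral_const, intervalIntegral.integral_const_mul, integral_id, smul_eq_mul]
  ring

theorem setIntegral_Iic_eq_intervalIntegral {f : ℝ → ℝ} (hf : Continuous f) {m : ℝ}
    (hm : ∀ s ≤ m, f s = 0) (x : ℝ) : ∫ s in Set.Iic x, f s = ∫ s in m..x, f s := by
  have h0 : IntegrableOn f (Set.Iic m) :=
    (integrableOn_zero (ε' := ℝ)).congr_fun (fun s hs => (hm s hs).symm) measurableSet_Iic
  have hx : IntegrableOn f (Set.Iic x) := by
    refine (h0.union (hf.integrableOn_Icc (a := m) (b := x))).mono_set fun s hs => ?_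
    rcases le_total s m with h | h
    · exact Or.inl h
    · exact Or.inr ⟨h, hs⟩
  rw [← intervalIntegral.integral_Iic_sub_Iic h0 hx, setIntegral_congr_fun measurableSet_Iic hm]
  simp

theorem intervalIntegral_swap_of_continuous {f : ℝ × ℝ → ℝ} (hf : Continuous f) (a b u v : ℝ) :
    ∫ s in a..b, ∫ t in u..v, f (s, t) = ∫ t in u..v, ∫ s in a..b, f (s, t) := by
  simp only [intervalIntegral.intervalIntegral_eq_integral_uIoc (a := u) (b := v), smul_eq_mul]
  rw [intervalIntegral.integral_const_mul]
  congr 1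
  refine intervalIntegral_integral_swap ?_
  rw [Measure.prod_restrict]
  exact (hf.continuousOn.integrableOn_compact (isCompact_uIcc.prod isCompact_uIcc)).mono_set
    (Set.prod_mono Set.uIoc_subset_uIcc Set.uIoc_subset_uIcc)

/-! ### The integrated function -/

/-- A function vanishing off the mesh and biquadratic on each cell. -/
structure IsBiquadSpline (T : TMesh) (f : ℝ × ℝ → ℝ) : Prop where
  zero : ∀ p, p ∉ T.Omega → f p = 0
  biquad : ∀ c ∈ T.cells, ∃ A : ℕ → ℕ → ℝ, ∀ x y, (x, y) ∈ c.toSet →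
    f (x, y) = ∑ i ∈ Finset.range 3, ∑ j ∈ Finset.range 3, A i j * (x ^ i * y ^ j)

theorem IsBiquadSpline.swap {T : TMesh} {f : ℝ × ℝ → ℝ} (hf : IsBiquadSpline T f) :
    IsBiquadSpline T.swap (f ∘ Prod.swap) where
  zero := fun p hp => hf.zero _ (by rwa [TMesh.Omega_swap] at hp)
  biquad := fun c hc => by
    obtain ⟨A, h⟩ := hf.biquad c.swap hc
    refine ⟨fun i j => A j i, fun x y hxy => ?_⟩
    have := h y x (by rw [Rect.toSet_swap]; exact hxy)
    simp only [Function.comp_apply, Prod.swap_prod_mk, this]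
    rw [Finset.sum_comm]
    simp only [mul_comm (y ^ _)]

theorem isBiquadSpline_iff {T : TMesh} {f : ℝ × ℝ → ℝ} :
    IsBiquadSpline T f ↔ (∀ p, p ∉ T.Omega → f p = 0) ∧ PiecewisePoly 2 2 T f := by
  constructor
  · rintro ⟨h1, h2⟩
    refine ⟨h1, fun c hc => ?_⟩
    obtain ⟨A, hA⟩ := h2 c hc
    obtain ⟨p, hp0, hp1, hp⟩ := exists_mvPolynomial_eval_eq_sum 2 2 A
    exact ⟨p, hp0, hp1, fun q hq => by rw [hp]; exact hA q.1 q.2 hq⟩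
  · rintro ⟨h1, h2⟩
    refine ⟨h1, fun c hc => ?_⟩
    obtain ⟨p, hp0, hp1, hp⟩ := h2 c hc
    obtain ⟨A, hA⟩ := exists_eval_eq_sum hp0 hp1
    exact ⟨A, fun x y hxy => by rw [hp _ hxy]; exact hA x y⟩

theorem isBilinearSpline_of_mem {T : TMesh} {g : ℝ × ℝ → ℝ} (hg : g ∈ SBar 1 1 0 0 T) :
    IsBilinearSpline T g where
  continuous := continuousOn_univ.1 (hg.2.2.1 0 0 le_rfl le_rfl)
  zero := hg.1
  bilin := fun c hc => by
    obtain ⟨p, hp0, hp1, hp⟩ := hg.2.1 c hc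
    obtain ⟨A, hA⟩ := exists_eval_eq_sum hp0 hp1
    refine ⟨A 0 0, A 1 0, A 0 1, A 1 1, fun x y hxy => ?_⟩
    rw [hp _ hxy, hA x y]
    simp [Finset.sum_range_succ]
    ring

namespace IsBilinearSpline

variable {T : TMesh} {g : ℝ × ℝ → ℝ}

theorem continuous_rowInt (hg : IsBilinearSpline T g) :
    Continuous fun p : ℝ × ℝ => rowInt T g p.1 p.2 := by
  have hc := hg.continuous
  exact intervalIntegral.continuous_parametric_intervalIntegral_of_continuous
    (f := fun (p : ℝ × ℝ) s => g (s, p.2)) (by fun_prop) continuous_fst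

theorem continuous_rowInt_right (hg : IsBilinearSpline T g) (x : ℝ) :
    Continuous fun y => rowInt T g x y :=
  hg.continuous_rowInt.comp (Continuous.prodMk_right x)

theorem hasDerivAt_rowInt (hg : IsBilinearSpline T g) (x y : ℝ) :
    HasDerivAt (fun x => rowInt T g x y) (g (x, y)) x :=
  intervalIntegral.integral_hasDerivAt_right ((hg.continuous_row y).intervalIntegrable _ _)
    ((hg.continuous_row y).stronglyMeasurableAtFilter _ _) (hg.continuous_row y).continuousAt

theorem rowInt_eq_zero (hg : IsBilinearSpline T g) {x y : ℝ}
    (h : x ≤ T.outer.xmin ∨ y ≤ T.outer.ymin ∨ T.outer.ymax ≤ y) : rowInt T g x y = 0 := by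
  rw [rowInt, intervalIntegral.integral_congr (g := fun _ => (0 : ℝ)),
    intervalIntegral.integral_zero]
  intro s hs
  refine hg.zero_of_le ?_
  rcases h with h | h
  · exact Or.inl (hs.2.trans (max_le (by linarith) h))
  · exact Or.inr (Or.inr h)

/-- The integrated function as an integral of column integrals. -/
theorem Ig_eq_integral_colInt (hg : IsBilinearSpline T g) (x y : ℝ) :
    Ig g (x, y) = ∫ s in (T.outer.xmin - 1)..x, rowInt T.swap (g ∘ Prod.swap) y s := by
  have h1 : ∀ s, ∫ t in Set.Iic y, g (s, t) = rowInt T.swap (g ∘ Prod.swap) y s := fun s =>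
    setIntegral_Iic_eq_intervalIntegral (hg.swap.continuous_row s) (m := T.outer.ymin - 1)
      (fun t ht => hg.zero_of_le (Or.inr (Or.inr (Or.inl (by linarith))))) y
  rw [Ig]
  simp only [h1]
  exact setIntegral_Iic_eq_intervalIntegral (hg.swap.continuous_rowInt_right y)
    (fun s hs => hg.swap.rowInt_eq_zero (Or.inr (Or.inl (by
      change s ≤ T.outer.xmin; linarith)))) x

/-- The integrated function as an integral of row integrals. -/
theorem Ig_eq_integral_rowInt (hg : IsBilinearSpline T g) (x y : ℝ) :
    Ig g (x, y) = ∫ t in (T.outer.ymin - 1)..y, rowInt T g x t := by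
  rw [hg.Ig_eq_integral_colInt]
  exact intervalIntegral_swap_of_continuous hg.continuous _ _ _ _

theorem Ig_swap (hg : IsBilinearSpline T g) : Ig (g ∘ Prod.swap) = Ig g ∘ Prod.swap := by
  ext ⟨x, y⟩
  rw [hg.swap.Ig_eq_integral_colInt, Function.comp_apply, Prod.swap_prod_mk,
    hg.Ig_eq_integral_rowInt]
  rfl

theorem hasDerivAt_Ig_right (hg : IsBilinearSpline T g) (x y : ℝ) :
    HasDerivAt (fun y => Ig g (x, y)) (rowInt T g x y) y := by
  simp only [hg.Ig_eq_integral_rowInt]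
  exact intervalIntegral.integral_hasDerivAt_right
    ((hg.continuous_rowInt_right x).intervalIntegrable _ _)
    ((hg.continuous_rowInt_right x).stronglyMeasurableAtFilter _ _)
    (hg.continuous_rowInt_right x).continuousAt

theorem hasDerivAt_Ig_left (hg : IsBilinearSpline T g) (x y : ℝ) :
    HasDerivAt (fun x => Ig g (x, y)) (rowInt T.swap (g ∘ Prod.swap) y x) x := by
  have := hg.swap.hasDerivAt_Ig_right y x
  rwa [hg.Ig_swap] at this

theorem continuous_Ig (hg : IsBilinearSpline T g) : Continuous (Ig g) := by
  have h : Ig g = fun p => ∫ t in (T.outer.ymin - 1)..p.2, rowInt T g p.1 t :=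
    funext fun p => hg.Ig_eq_integral_rowInt p.1 p.2
  rw [h]
  exact intervalIntegral.continuous_parametric_intervalIntegral_of_continuous
    (f := fun (p : ℝ × ℝ) t => rowInt T g p.1 t)
    (hg.continuous_rowInt.comp (by fun_prop : Continuous fun q : (ℝ × ℝ) × ℝ => (q.1.1, q.2)))
    continuous_snd

theorem smoothWithin_Ig (hg : IsBilinearSpline T g) : SmoothWithin Set.univ 1 1 (Ig g) := by
  have hX : pdXW Set.univ (Ig g) = fun p => rowInt T.swap (g ∘ Prod.swap) p.2 p.1 := by
    ext ⟨x, y⟩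
    simpa [pdXW] using (hg.hasDerivAt_Ig_left x y).deriv
  have hY : pdYW Set.univ (Ig g) = fun p => rowInt T g p.1 p.2 := by
    ext ⟨x, y⟩
    simpa [pdYW] using (hg.hasDerivAt_Ig_right x y).deriv
  have hXY : pdYW Set.univ (pdXW Set.univ (Ig g)) = g := by
    rw [hX]
    ext ⟨x, y⟩
    simpa [pdYW] using (hg.swap.hasDerivAt_rowInt y x).deriv
  refine ⟨fun i j hi hj => ?_, fun i hi p _ => ?_, fun i j hi hj p _ => ?_⟩
  · have hi : i ≤ 1 := by exact_mod_cast hi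
    have hj : j ≤ 1 := by exact_mod_cast hj
    rw [continuousOn_univ]
    interval_cases i <;> interval_cases j <;>
      simp only [mpW, Function.iterate_zero, Function.iterate_one, id]
    · exact hg.continuous_Ig
    · rw [hY]; exact hg.continuous_rowInt
    · rw [hX]; exact hg.swap.continuous_rowInt.comp continuous_swap
    · rw [hXY]; exact hg.continuous
  · have hi : i = 0 := by omega
    subst hi
    simp only [zero_add, Function.iterate_zero, Function.iterate_one, id, hX]
    exact (hg.hasDerivAt_Ig_left p.1 p.2).hasDerivWithinAt
  · have hi : i ≤ 1 := by exact_mod_cast hi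
    have hj : j = 0 := by omega
    subst hj
    interval_cases i <;>
      simp only [mpW, zero_add, Function.iterate_zero, Function.iterate_one, id]
    · rw [hY]; exact (hg.hasDerivAt_Ig_right p.1 p.2).hasDerivWithinAt
    · rw [hXY, hX]; exact (hg.swap.hasDerivAt_rowInt p.2 p.1).hasDerivWithinAt

theorem locally_affine_rowInt (hg : IsBilinearSpline T g) (hF : IsBiquadSpline T (Ig g)) {x y : ℝ}
    (hxy : (x, y) ∉ T.skeleton) : ∃ α β : ℝ, ∀ᶠ t in 𝓝 y, rowInt T g x t = α + β * t := by
  have hcont : Continuous fun t : ℝ => (x, t) := Continuous.prodMk_right x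
  obtain ⟨a, b, c, h⟩ : ∃ a b c : ℝ, ∀ᶠ t in 𝓝 y, Ig g (x, t) = a + b * t + c * t ^ 2 := by
    by_cases hΩ : (x, y) ∈ T.Omega
    · obtain ⟨c, hc, hmem⟩ := TMesh.exists_mem_interior hΩ hxy
      obtain ⟨A, hA⟩ := hF.biquad c hc
      refine ⟨∑ i ∈ Finset.range 3, A i 0 * x ^ i, ∑ i ∈ Finset.range 3, A i 1 * x ^ i,
        ∑ i ∈ Finset.range 3, A i 2 * x ^ i, ?_⟩
      filter_upwards [(isOpen_interior.preimage hcont).mem_nhds hmem] with t ht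
      rw [hA x t (interior_subset ht)]
      simp only [Finset.sum_range_succ, Finset.sum_range_zero]
      ring
    · refine ⟨0, 0, 0, ?_⟩
      filter_upwards [(T.outer.isClosed_toSet.isOpen_compl.preimage hcont).mem_nhds hΩ] with t ht
      rw [hF.zero _ ht]
      ring
  refine ⟨b, 2 * c, ?_⟩
  filter_upwards [eventually_eventually_nhds.2 h] with t ht
  have h1 : HasDerivAt (fun t => a + b * t + c * t ^ 2) (b + 2 * c * t) t := by
    have := (((hasDerivAt_id' t).const_mul b).const_add a).fun_add
      ((hasDerivAt_pow 2 t).const_mul c)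
    refine this.congr_deriv ?_
    push_cast
    ring
  exact (hg.hasDerivAt_Ig_right x t).unique (h1.congr_of_eventuallyEq ht)

theorem Ig_eq_zero_of_xmax_lt (hg : IsBilinearSpline T g)
    (h : ∀ x y, (x, y) ∉ T.skeleton → ∃ α β : ℝ, ∀ᶠ t in 𝓝 y, rowInt T g x t = α + β * t)
    {x : ℝ} (hx : T.outer.xmax < x) (y : ℝ) : Ig g (x, y) = 0 := by
  have hz : ∀ t, rowInt T g x t = 0 := by
    intro t
    by_cases ht : t ≤ T.outer.ymin
    · exact hg.rowInt_eq_zero (Or.inr (Or.inl ht))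
    push Not at ht
    obtain ⟨α, β, hab⟩ := exists_affine_of_locally_affine (u := T.outer.ymin - 1) (v := t)
      (by linarith) (hg.continuous_rowInt_right x) (fun r _ => h x r fun hmem =>
        absurd (Rect.mem_toSet.1 (T.skeleton_subset hmem)).1.2 (not_le.2 hx))
    have e1 := hab (T.outer.ymin - 1) ⟨le_rfl, by linarith⟩
    have e2 := hab T.outer.ymin ⟨by linarith, ht.le⟩
    rw [hg.rowInt_eq_zero (Or.inr (Or.inl (by linarith)))] at e1 e2
    have hβ : β = 0 := by linarith
    subst hβ
    rw [hab t ⟨by linarith, le_rfl⟩]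
    linarith
  rw [hg.Ig_eq_integral_rowInt]
  simp [hz]

theorem isBiquadSpline_Ig (hg : IsBilinearSpline T g)
    (hrow : ∀ x y, (x, y) ∉ T.skeleton → ∃ α β : ℝ, ∀ᶠ t in 𝓝 y, rowInt T g x t = α + β * t)
    (hcol : ∀ x y, (x, y) ∉ T.swap.skeleton →
      ∃ α β : ℝ, ∀ᶠ t in 𝓝 y, rowInt T.swap (g ∘ Prod.swap) x t = α + β * t) :
    IsBiquadSpline T (Ig g) where
  zero := by
    rintro ⟨x, y⟩ hp
    by_cases h1 : T.outer.xmax < x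
    · exact hg.Ig_eq_zero_of_xmax_lt hrow h1 y
    by_cases h2 : T.outer.ymax < y
    · have := hg.swap.Ig_eq_zero_of_xmax_lt hcol h2 x
      rwa [hg.Ig_swap] at this
    push Not at h1 h2
    rw [hg.Ig_eq_integral_rowInt, intervalIntegral.integral_congr (g := fun _ => (0 : ℝ)),
      intervalIntegral.integral_zero]
    intro t ht
    by_cases h3 : x ≤ T.outer.xmin
    · exact hg.rowInt_eq_zero (Or.inl h3)
    · refine hg.rowInt_eq_zero (Or.inr (Or.inl (ht.2.trans (max_le (by linarith) ?_))))
      by_contra! h4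
      push Not at h3
      exact hp (Rect.mem_toSet.2 ⟨⟨h3.le, h1⟩, h4.le, h2⟩)
  biquad := by
    intro c hc
    obtain ⟨u, hu⟩ : (Set.Ioo c.xmin c.xmax).Nonempty := Set.nonempty_Ioo.2 c.hx
    obtain ⟨v, hv⟩ : (Set.Ioo c.ymin c.ymax).Nonempty := Set.nonempty_Ioo.2 c.hy
    obtain ⟨α, β, hr⟩ := exists_affine_of_locally_affine c.hy (hg.continuous_rowInt_right u)
      (fun y hy => hrow u y (TMesh.notMem_skeleton_of_mem_interior hc
        (Rect.mem_interior.2 ⟨hu, hy⟩)))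
    obtain ⟨γ, δ, hl⟩ := exists_affine_of_locally_affine c.hx (hg.swap.continuous_rowInt_right v)
      (fun x hx => hcol v x fun hmem => TMesh.notMem_skeleton_of_mem_interior hc
        (Rect.mem_interior.2 ⟨hx, hv⟩) (mem_skeleton_swap.1 hmem))
    obtain ⟨a, b, k, d, hb⟩ := hg.bilin c hc
    have hu' : u ∈ Set.Icc c.xmin c.xmax := ⟨hu.1.le, hu.2.le⟩
    have hv' : v ∈ Set.Icc c.ymin c.ymax := ⟨hv.1.le, hv.2.le⟩
    have hF : ∀ x y, (x, y) ∈ c.toSet → Ig g (x, y) = Ig g (u, v)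
        + (α * (y - v) + β * ((y ^ 2 - v ^ 2) / 2)) + (γ * (x - u) + δ * ((x ^ 2 - u ^ 2) / 2))
        + (a * (y - v) + k * ((y ^ 2 - v ^ 2) / 2)) * (x - u)
        + (b * (y - v) + d * ((y ^ 2 - v ^ 2) / 2)) * ((x ^ 2 - u ^ 2) / 2) := by
      rintro x y ⟨hx, hy⟩
      have hsx := Set.uIcc_subset_Icc hu' hx
      have hsy := Set.uIcc_subset_Icc hv' hy
      have e1 : Ig g (u, y) - Ig g (u, v) = α * (y - v) + β * ((y ^ 2 - v ^ 2) / 2) := by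
        rw [hg.Ig_eq_integral_rowInt, hg.Ig_eq_integral_rowInt,
          intervalIntegral.integral_interval_sub_left
            ((hg.continuous_rowInt_right u).intervalIntegrable _ _)
            ((hg.continuous_rowInt_right u).intervalIntegrable _ _), ← integral_affine]
        exact intervalIntegral.integral_congr fun t ht => hr t (hsy ht)
      have e2 : ∀ s ∈ Set.uIcc u x, rowInt T.swap (g ∘ Prod.swap) y s =
          (γ + (a * (y - v) + k * ((y ^ 2 - v ^ 2) / 2)))
          + (δ + (b * (y - v) + d * ((y ^ 2 - v ^ 2) / 2))) * s := by
        intro s hs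
        have e3 : rowInt T.swap (g ∘ Prod.swap) y s - rowInt T.swap (g ∘ Prod.swap) v s =
            (a + b * s) * (y - v) + (k + d * s) * ((y ^ 2 - v ^ 2) / 2) := by
          rw [rowInt, rowInt, intervalIntegral.integral_interval_sub_left
            ((hg.swap.continuous_row s).intervalIntegrable _ _)
            ((hg.swap.continuous_row s).intervalIntegrable _ _), ← integral_affine]
          refine intervalIntegral.integral_congr fun t ht => ?_
          have := hb s t ⟨hsx hs, hsy ht⟩
          simp only [Function.comp_apply, Prod.swap_prod_mk, this]
          ring
        rw [hl s (hsx hs)] at e3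
        linear_combination e3
      have e4 : Ig g (x, y) - Ig g (u, y) =
          (γ + (a * (y - v) + k * ((y ^ 2 - v ^ 2) / 2))) * (x - u)
          + (δ + (b * (y - v) + d * ((y ^ 2 - v ^ 2) / 2))) * ((x ^ 2 - u ^ 2) / 2) := by
        rw [hg.Ig_eq_integral_colInt, hg.Ig_eq_integral_colInt,
          intervalIntegral.integral_interval_sub_left
            ((hg.swap.continuous_rowInt_right y).intervalIntegrable _ _)
            ((hg.swap.continuous_rowInt_right y).intervalIntegrable _ _), ← integral_affine]
        exact intervalIntegral.integral_congr e2
      linear_combination e1 + e4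
    refine ⟨fun i j =>
      if i = 0 then
        if j = 0 then Ig g (u, v) - α * v - β * v ^ 2 / 2 - γ * u - δ * u ^ 2 / 2
          + (a * v + k * v ^ 2 / 2) * u + (b * v + d * v ^ 2 / 2) * u ^ 2 / 2
        else if j = 1 then α - a * u - b * u ^ 2 / 2
        else β / 2 - k / 2 * u - d / 2 * u ^ 2 / 2
      else if i = 1 then
        if j = 0 then γ - a * v - k * v ^ 2 / 2 else if j = 1 then a else k / 2
      else
        if j = 0 then δ / 2 - (b * v + d * v ^ 2 / 2) / 2 else if j = 1 then b / 2 else d / 4,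
      fun x y hxy => ?_⟩
    rw [hF x y hxy]
    simp [Finset.sum_range_succ]
    ring

theorem vert_condition_iff (hg : IsBilinearSpline T g) :
    (∀ x a b : ℝ, a < b → IsLEdge T (({x} : Set ℝ) ×ˢ Set.Icc a b) →
        (∫ t in a..b, limLeftX (pdX g) x t) = ∫ t in a..b, limRightX (pdX g) x t) ↔
      ∀ x y, (x, y) ∉ T.swap.skeleton →
        ∃ α β : ℝ, ∀ᶠ t in 𝓝 y, rowInt T.swap (g ∘ Prod.swap) x t = α + β * t := by
  rw [← hg.swap.horiz_condition_iff]
  constructor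
  · rintro h a b y ⟨hab, hl⟩
    exact h y a b hab ((isLEdge_vert_iff T).2 hl)
  · intro h x a b hab hl
    exact h a b x ⟨hab, (isLEdge_vert_iff T).1 hl⟩

end IsBilinearSpline

/-- **Lemma 4.1.** For `g ∈ S̄(1,1,0,0,T)`, `I(g) ∈ S̄(2,2,1,1,T)` iff for every horizontal
l-edge the integrals of the one-sided limits of the cell-wise `∂g/∂y` from below and above
agree, and for every vertical l-edge the integrals of the one-sided limits of the cell-wise
`∂g/∂x` from the left and the right agree. -/
theorem Ig_mem_SBar2211_iff (T : TMesh) (g : ℝ × ℝ → ℝ) (hg : g ∈ SBar 1 1 0 0 T) :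
    Ig g ∈ SBar 2 2 1 1 T ↔
      ((∀ a b y : ℝ, HorizLEdgeAt T a b y →
          (∫ s in a..b, limBelowY (pdY g) y s) = ∫ s in a..b, limAboveY (pdY g) y s) ∧
       (∀ x a b : ℝ, a < b → IsLEdge T (({x} : Set ℝ) ×ˢ Set.Icc a b) →
          (∫ t in a..b, limLeftX (pdX g) x t) = ∫ t in a..b, limRightX (pdX g) x t)) := by
  have hB := isBilinearSpline_of_mem hg
  rw [hB.horiz_condition_iff, hB.vert_condition_iff]
  constructor
  · intro hF
    have hQ := isBiquadSpline_iff.2 ⟨hF.1, hF.2.1⟩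
    refine ⟨fun x y => hB.locally_affine_rowInt hQ, fun x y => hB.swap.locally_affine_rowInt ?_⟩
    rw [hB.Ig_swap]
    exact hQ.swap
  · rintro ⟨h1, h2⟩
    have hQ := isBiquadSpline_iff.1 (hB.isBiquadSpline_Ig h1 h2)
    exact ⟨hQ.1, hQ.2, hB.smoothWithin_Ig⟩
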